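/- For all n and k, e(2n+1, 2k) = o(2n+1, 2k); that is, among 321-avoiding permutations of odd length 2n+1 whose longest increasing subsequence has even length 2k, there are exactly as many even permutations as odd permutations. -/

import Mathlib

open scoped Classical
open Polynomial

/-- A permutation of `{1,…,n}` (modeled on `Fin n`) is 321-avoiding if there are no
indices `i < j < k` with `π i > π j > π k`. -/
def Avoids321 {n : ℕ} (π : Equiv.Perm (Fin n)) : Prop :=
  ¬ ∃ i j k : Fin n, i < j ∧ j < k ∧ π k < π j ∧ π j < π i

/-- The length of the longest increasing subsequence of a permutation. -/
noncomputable def lis {n : ℕ} (π : Equiv.Perm (Fin n)) : ℕ :=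
  sSup {k : ℕ | ∃ s : Finset (Fin n),
    (∀ i ∈ s, ∀ j ∈ s, i < j → π i < π j) ∧ s.card = k}

/-- `eCount n k` is the number of even 321-avoiding permutations of `{1,…,n}`
whose longest increasing subsequence has length `k`. -/
noncomputable def eCount (n k : ℕ) : ℕ :=
  Nat.card {π : Equiv.Perm (Fin n) // Avoids321 π ∧ lis π = k ∧ Equiv.Perm.sign π = 1}

/-- `oCount n k` is the number of odd 321-avoiding permutations of `{1,…,n}`
whose longest increasing subsequence has length `k`. -/
noncomputable def oCount (n k : ℕ) : ℕ :=
  Nat.card {π : Equiv.Perm (Fin n) // Avoids321 π ∧ lis π = k ∧ Equiv.Perm.sign π = -1}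

/-! ### Insertion of a first letter -/

/-- The permutation with first letter `v` whose remaining letters are in the same relative order
as those of `π`. -/
def consPerm {n : ℕ} (v : Fin (n + 1)) (π : Equiv.Perm (Fin n)) : Equiv.Perm (Fin (n + 1)) :=
  v.cycleRange.symm * Equiv.Perm.decomposeFin.symm (0, π)

@[simp] theorem consPerm_zero {n : ℕ} (v : Fin (n + 1)) (π : Equiv.Perm (Fin n)) :
    consPerm v π 0 = v := by
  simp [consPerm]

@[simp] theorem consPerm_succ {n : ℕ} (v : Fin (n + 1)) (π : Equiv.Perm (Fin n)) (i : Fin n) :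
    consPerm v π i.succ = v.succAbove (π i) := by
  simp [consPerm]

theorem sign_consPerm {n : ℕ} (v : Fin (n + 1)) (π : Equiv.Perm (Fin n)) :
    ((Equiv.Perm.sign (consPerm v π) : ℤˣ) : ℤ) = (-1) ^ (v : ℕ) * (Equiv.Perm.sign π : ℤˣ) := by
  simp [consPerm, Equiv.Perm.sign_symm]

theorem consPerm_injective (n : ℕ) :
    Function.Injective fun p : Fin (n + 1) × Equiv.Perm (Fin n) => consPerm p.1 p.2 := by
  rintro ⟨v, π⟩ ⟨w, σ⟩ h
  have hv : v = w := by simpa using DFunLike.congr_fun h 0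
  subst hv
  refine Prod.ext rfl (Equiv.ext fun i => ?_)
  simpa using DFunLike.congr_fun h i.succ

theorem consPerm_bijective (n : ℕ) :
    Function.Bijective fun p : Fin (n + 1) × Equiv.Perm (Fin n) => consPerm p.1 p.2 := by
  refine (Fintype.bijective_iff_injective_and_card _).2 ⟨consPerm_injective n, ?_⟩
  simp [Fintype.card_perm, Nat.factorial_succ]

/-- Permutations of `n + 1` letters correspond to a first letter and a permutation of `n`
letters. -/
noncomputable def consEquiv (n : ℕ) :
    Fin (n + 1) × Equiv.Perm (Fin n) ≃ Equiv.Perm (Fin (n + 1)) :=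
  Equiv.ofBijective _ (consPerm_bijective n)

theorem consEquiv_apply {n : ℕ} (v : Fin (n + 1)) (π : Equiv.Perm (Fin n)) :
    consEquiv n (v, π) = consPerm v π := rfl

theorem val_succAbove {n : ℕ} (v : Fin (n + 1)) (x : Fin n) :
    (v.succAbove x : ℕ) = if (x : ℕ) < v then (x : ℕ) else x + 1 := by
  simp only [Fin.succAbove, Fin.lt_def, Fin.val_castSucc]
  split_ifs <;> simp

/-! ### Increasing subsequences with bounded values -/

/-- `π` has an increasing subsequence of length `m` all of whose values are at least `c`. -/
def HasInc {n : ℕ} (π : Equiv.Perm (Fin n)) (c m : ℕ) : Prop :=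
  ∃ s : Finset (Fin n), (∀ i ∈ s, ∀ j ∈ s, i < j → π i < π j) ∧ (∀ i ∈ s, c ≤ (π i : ℕ)) ∧
    s.card = m

/-- All larger letters of inversions of `π` are at least `c`. -/
def TopsGE {n : ℕ} (π : Equiv.Perm (Fin n)) (c : ℕ) : Prop :=
  ∀ i j, i < j → π j < π i → c ≤ (π i : ℕ)

theorem hasInc_of_consPerm {n : ℕ} {v : Fin (n + 1)} {π : Equiv.Perm (Fin n)} {c m : ℕ}
    (hc : c ≤ v) (h : HasInc (consPerm v π) c m) :
    HasInc π c m ∨ ∃ k, m = k + 1 ∧ HasInc π v k := by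
  obtain ⟨s, hs, hsc, rfl⟩ := h
  set t : Finset (Fin n) := s.preimage Fin.succ (Fin.succ_injective n).injOn with ht
  have hmem : ∀ i, i ∈ t ↔ i.succ ∈ s := by simp [ht]
  have hinc : ∀ i ∈ t, ∀ j ∈ t, i < j → π i < π j := by
    intro i hi j hj hij
    have := hs _ ((hmem i).1 hi) _ ((hmem j).1 hj) (Fin.succ_lt_succ_iff.2 hij)
    simpa using this
  by_cases h0 : (0 : Fin (n + 1)) ∈ s
  · right
    have hst : s = insert 0 (t.map (Fin.succEmb n)) := by
      ext i
      induction i using Fin.cases with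
      | zero => simp [h0]
      | succ i => simp [hmem]
    refine ⟨t.card, ?_, t, hinc, ?_, rfl⟩
    · rw [hst, Finset.card_insert_of_notMem (by simp), Finset.card_map]
    · intro i hi
      have := hs _ h0 _ ((hmem i).1 hi) (Fin.succ_pos i)
      rw [consPerm_zero, consPerm_succ, Fin.lt_def, val_succAbove] at this
      split_ifs at this <;> omega
  · left
    have hst : s = t.map (Fin.succEmb n) := by
      ext i
      induction i using Fin.cases with
      | zero => simp [h0]
      | succ i => simp [hmem]
    refine ⟨t, hinc, ?_, ?_⟩
    · intro i hi
      have := hsc _ ((hmem i).1 hi)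
      rw [consPerm_succ, val_succAbove] at this
      split_ifs at this <;> omega
    · rw [hst, Finset.card_map]

theorem HasInc.cons {n : ℕ} {π : Equiv.Perm (Fin n)} {c m : ℕ} (h : HasInc π c m)
    (v : Fin (n + 1)) : HasInc (consPerm v π) c m := by
  obtain ⟨s, hs, hsc, rfl⟩ := h
  refine ⟨s.map (Fin.succEmb n), ?_, ?_, by simp⟩
  · simp only [Finset.mem_map, Fin.coe_succEmb, forall_exists_index, and_imp,
      forall_apply_eq_imp_iff₂, consPerm_succ, Fin.succ_lt_succ_iff, Fin.succAbove_lt_succAbove_iff]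
    exact hs
  · simp only [Finset.mem_map, Fin.coe_succEmb, forall_exists_index, and_imp,
      forall_apply_eq_imp_iff₂, consPerm_succ, val_succAbove]
    intro i hi
    have := hsc i hi
    split_ifs <;> omega

theorem HasInc.cons_succ {n : ℕ} {π : Equiv.Perm (Fin n)} {v : Fin (n + 1)} {c m : ℕ}
    (h : HasInc π v m) (hc : c ≤ v) : HasInc (consPerm v π) c (m + 1) := by
  obtain ⟨s, hs, hsv, rfl⟩ := h
  refine ⟨insert 0 (s.map (Fin.succEmb n)), ?_, ?_, ?_⟩
  · have hlt : ∀ i ∈ s, v < v.succAbove (π i) := by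
      intro i hi
      have := hsv i hi
      rw [Fin.lt_def, val_succAbove]
      split_ifs <;> omega
    intro i hi j hj hij
    induction i using Fin.cases with
    | zero =>
      induction j using Fin.cases with
      | zero => exact absurd hij (lt_irrefl _)
      | succ j => simpa using hlt j (by simpa using hj)
    | succ i =>
      induction j using Fin.cases with
      | zero => exact absurd hij (Fin.not_lt_zero _)
      | succ j =>
        simpa using hs i (by simpa using hi) j (by simpa using hj) (Fin.succ_lt_succ_iff.1 hij)
  · intro i hi
    induction i using Fin.cases with
    | zero => simpa using hc
    | succ i =>
      have := hsv i (by simpa using hi)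
      rw [consPerm_succ, val_succAbove]
      split_ifs <;> omega
  · rw [Finset.card_insert_of_notMem (by simp), Finset.card_map]

theorem hasInc_consPerm_zero {n : ℕ} {π : Equiv.Perm (Fin n)} {c m : ℕ} :
    HasInc (consPerm 0 π) (c + 1) m ↔ HasInc π c m := by
  constructor
  · rintro ⟨s, hs, hsc, rfl⟩
    set t : Finset (Fin n) := s.preimage Fin.succ (Fin.succ_injective n).injOn with ht
    have hmem : ∀ i, i ∈ t ↔ i.succ ∈ s := by simp [ht]
    have h0 : (0 : Fin (n + 1)) ∉ s := fun h => by simpa using hsc 0 h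
    have hst : s = t.map (Fin.succEmb n) := by
      ext i
      induction i using Fin.cases with
      | zero => simp [h0]
      | succ i => simp [hmem]
    refine ⟨t, ?_, ?_, by rw [hst, Finset.card_map]⟩
    · intro i hi j hj hij
      simpa using hs _ ((hmem i).1 hi) _ ((hmem j).1 hj) (Fin.succ_lt_succ_iff.2 hij)
    · intro i hi
      simpa using hsc _ ((hmem i).1 hi)
  · rintro ⟨s, hs, hsc, rfl⟩
    refine ⟨s.map (Fin.succEmb n), ?_, ?_, by simp⟩
    · simpa using hs
    · simpa using hsc

theorem topsGE_consPerm {n : ℕ} {v : Fin (n + 1)} {π : Equiv.Perm (Fin n)} (c : ℕ)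
    (hv : TopsGE π v) :
    TopsGE (consPerm v π) c ↔ (TopsGE π (c - 1)) ∧ (v = 0 ∨ c ≤ v) := by
  constructor
  · intro h
    constructor
    · intro i j hij hji
      have h1 := h i.succ j.succ (by simpa using hij) (by simpa using hji)
      rw [consPerm_succ, val_succAbove] at h1
      split_ifs at h1 <;> omega
    · by_contra! hcon
      obtain ⟨h0, hvc⟩ := hcon
      have hpos : 0 < (v : ℕ) := Nat.pos_of_ne_zero fun h' => h0 (Fin.ext h')
      have hn : 0 < n := by omega
      have h1 := h 0 (π.symm ⟨0, hn⟩).succ (Fin.succ_pos _) (by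
        rw [consPerm_zero, consPerm_succ, Fin.lt_def, val_succAbove]
        simp [hpos])
      rw [consPerm_zero] at h1
      omega
  · rintro ⟨h, hvc⟩ i j hij hji
    induction j using Fin.cases with
    | zero => exact absurd hij (Fin.not_lt_zero _)
    | succ j =>
      induction i using Fin.cases with
      | zero =>
        rcases hvc with rfl | hvc
        · simp at hji
        · simpa using hvc
      | succ i =>
        have hij' := Fin.succ_lt_succ_iff.1 hij
        rw [consPerm_succ, consPerm_succ, Fin.succAbove_lt_succAbove_iff] at hji
        have h1 := h i j hij' hji
        have h2 := hv i j hij' hji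
        rw [consPerm_succ, val_succAbove]
        split_ifs <;> omega

theorem avoids321_consPerm {n : ℕ} {v : Fin (n + 1)} {π : Equiv.Perm (Fin n)} :
    Avoids321 (consPerm v π) ↔ Avoids321 π ∧ TopsGE π v := by
  constructor
  · intro h
    constructor
    · rintro ⟨i, j, k, hij, hjk, h1, h2⟩
      exact h ⟨i.succ, j.succ, k.succ, by simpa using hij, by simpa using hjk, by simpa using h1,
        by simpa using h2⟩
    · intro i j hij hji
      by_contra! hlt
      refine h ⟨0, i.succ, j.succ, Fin.succ_pos _, by simpa using hij, by simpa using hji, ?_⟩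
      rw [consPerm_zero, consPerm_succ, Fin.lt_def, val_succAbove, if_pos hlt]
      exact hlt
  · rintro ⟨h, hv⟩ ⟨i, j, k, hij, hjk, h1, h2⟩
    induction k using Fin.cases with
    | zero => exact absurd hjk (Fin.not_lt_zero _)
    | succ k =>
      induction j using Fin.cases with
      | zero => exact absurd hij (Fin.not_lt_zero _)
      | succ j =>
        rw [consPerm_succ, consPerm_succ, Fin.succAbove_lt_succAbove_iff] at h1
        induction i using Fin.cases with
        | zero =>
          have := hv j k (Fin.succ_lt_succ_iff.1 hjk) h1
          rw [consPerm_zero, consPerm_succ, Fin.lt_def, val_succAbove] at h2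
          split_ifs at h2 <;> omega
        | succ i =>
          rw [consPerm_succ, consPerm_succ, Fin.succAbove_lt_succAbove_iff] at h2
          exact h ⟨i, j, k, Fin.succ_lt_succ_iff.1 hij, Fin.succ_lt_succ_iff.1 hjk, h1, h2⟩

/-! ### The statistics tracked under insertion -/

/-- The effect of inserting the first letter `v` on the statistics described by `Tracks`. -/
def stepStat (v : ℕ) (x : ℕ × ℕ × ℕ) : ℕ × ℕ × ℕ :=
  if v = 0 then (x.1 + 1, x.2.1 + 1, x.2.2 + 1)
  else if x.2.2 = 0 then (x.1 + 1, v, 0)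
  else (x.1, v, min v x.2.2 - 1)

/-- The statistics `(l, d, t)` of `π`, computed by inserting its letters from right to left. -/
noncomputable def permStat : ∀ {n : ℕ}, Equiv.Perm (Fin n) → ℕ × ℕ × ℕ
  | 0, _ => (0, 0, 0)
  | n + 1, π => stepStat ((consEquiv n).symm π).1 (permStat ((consEquiv n).symm π).2)

theorem permStat_consPerm {n : ℕ} (v : Fin (n + 1)) (π : Equiv.Perm (Fin n)) :
    permStat (consPerm v π) = stepStat v (permStat π) := by
  rw [permStat, ← consEquiv_apply, Equiv.symm_apply_apply]

/-- `x = (l, d, t)` where `d` is the least larger letter of an inversion (or `n`), and, for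
`c ≤ d`, the longest increasing subsequence with values at least `c` has length `l - min t c`. -/
structure Tracks {n : ℕ} (π : Equiv.Perm (Fin n)) (x : ℕ × ℕ × ℕ) : Prop where
  le : x.2.1 ≤ n
  tops : ∀ c ≤ n, TopsGE π c ↔ c ≤ x.2.1
  exists_inc : ∀ c ≤ x.2.1, ∃ m, m + min x.2.2 c = x.1 ∧ HasInc π c m
  inc_le : ∀ c ≤ x.2.1, ∀ m, HasInc π c m → m + min x.2.2 c ≤ x.1

theorem Tracks.cons {n : ℕ} {π : Equiv.Perm (Fin n)} {x : ℕ × ℕ × ℕ} (h : Tracks π x)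
    (v : Fin (n + 1)) (hv : (v : ℕ) ≤ x.2.1) : Tracks (consPerm v π) (stepStat v x) := by
  obtain ⟨l, d, t⟩ := x
  obtain ⟨hle, htops, hex, hinc⟩ := h
  dsimp only at hle htops hex hinc hv
  have hvt : TopsGE π v := (htops v (by omega)).2 hv
  by_cases hv0 : v = 0
  · subst hv0
    simp only [stepStat, Fin.val_zero, if_true]
    refine ⟨by simpa using hle, ?_, ?_, ?_⟩
    · intro c hc
      rw [topsGE_consPerm c hvt, htops (c - 1) (by omega)]
      simp only [true_or, and_true]
      omega
    · rintro (_ | c) hc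
      · obtain ⟨m, hm, hm'⟩ := hex 0 (Nat.zero_le _)
        exact ⟨m + 1, by dsimp only; omega, hm'.cons_succ (v := 0) (by simp)⟩
      · obtain ⟨m, hm, hm'⟩ := hex c (by simpa using hc)
        exact ⟨m, by dsimp only; omega, hasInc_consPerm_zero.2 hm'⟩
    · rintro (_ | c) hc m hm
      · rcases hasInc_of_consPerm (by simp) hm with hm | ⟨k, rfl, hk⟩
        · have := hinc 0 (Nat.zero_le _) m hm
          dsimp only
          omega
        · have := hinc 0 (Nat.zero_le _) k hk
          dsimp only
          omega
      · have := hinc c (by simpa using hc) m (hasInc_consPerm_zero.1 hm)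
        dsimp only
        omega
  · have hpos : (v : ℕ) ≠ 0 := fun h => hv0 (Fin.ext h)
    have htops' : ∀ c ≤ n + 1, TopsGE (consPerm v π) c ↔ c ≤ v := by
      intro c hc
      rw [topsGE_consPerm c hvt, htops (c - 1) (by omega)]
      simp only [hv0, false_or]
      omega
    simp only [stepStat, hpos, if_false]
    split_ifs with ht
    · subst ht
      refine ⟨by dsimp only; omega, htops', ?_, ?_⟩
      · intro c hc
        obtain ⟨m, hm, hm'⟩ := hex v hv
        exact ⟨m + 1, by simp at hm ⊢; omega, hm'.cons_succ hc⟩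
      · intro c hc m hm
        dsimp only at hc ⊢
        rcases hasInc_of_consPerm hc hm with hm | ⟨k, rfl, hk⟩
        · have := hinc c (by omega) m hm
          omega
        · have := hinc v hv k hk
          omega
    · refine ⟨by dsimp only; omega, htops', ?_, ?_⟩
      · intro c hc
        dsimp only at hc ⊢
        by_cases hlt : c < min (v : ℕ) t
        · obtain ⟨m, hm, hm'⟩ := hex c (by omega)
          exact ⟨m, by omega, hm'.cons v⟩
        · obtain ⟨m, hm, hm'⟩ := hex v hv
          exact ⟨m + 1, by omega, hm'.cons_succ hc⟩
      · intro c hc m hm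
        dsimp only at hc ⊢
        rcases hasInc_of_consPerm hc hm with hm | ⟨k, rfl, hk⟩
        · have := hinc c (by omega) m hm
          omega
        · have := hinc v hv k hk
          omega

theorem tracks_permStat : ∀ {n : ℕ} (π : Equiv.Perm (Fin n)), Avoids321 π → Tracks π (permStat π)
  | 0, π, _ => by
    refine ⟨le_rfl, fun c hc => ⟨fun _ => hc, fun _ i => i.elim0⟩, ?_, ?_⟩
    · intro c _
      exact ⟨0, by simp [permStat], ∅, by simp⟩
    · rintro c _ m ⟨s, -, -, rfl⟩
      simp [permStat, Finset.eq_empty_of_isEmpty s]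
  | n + 1, π, h => by
    obtain ⟨⟨v, σ⟩, rfl⟩ := (consEquiv n).surjective π
    rw [consEquiv_apply] at h ⊢
    obtain ⟨hσ, hv⟩ := avoids321_consPerm.1 h
    have ih := tracks_permStat σ hσ
    rw [permStat_consPerm]
    exact ih.cons v ((ih.tops v (by omega)).1 hv)

theorem lis_eq_permStat {n : ℕ} {π : Equiv.Perm (Fin n)} (h : Avoids321 π) :
    lis π = (permStat π).1 := by
  have ht := tracks_permStat π h
  refine IsGreatest.csSup_eq ⟨?_, ?_⟩
  · obtain ⟨m, hm, s, hs, -, hsm⟩ := ht.exists_inc 0 (Nat.zero_le _)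
    exact ⟨s, hs, by simpa [← hsm] using hm⟩
  · rintro m ⟨s, hs, hsm⟩
    simpa using ht.inc_le 0 (Nat.zero_le _) m ⟨s, hs, by simp, hsm⟩

/-! ### Signed sums over 321-avoiding permutations -/

/-- The signed sum of `g (l, d, t)` over the 321-avoiding permutations of `n` letters. -/
noncomputable def signedSum (n : ℕ) (g : ℕ → ℕ → ℕ → ℤ) : ℤ :=
  ∑ π : Equiv.Perm (Fin n), if Avoids321 π then
    ((Equiv.Perm.sign π : ℤˣ) : ℤ) * g (permStat π).1 (permStat π).2.1 (permStat π).2.2 else 0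

theorem signedSum_add (n : ℕ) (g h : ℕ → ℕ → ℕ → ℤ) :
    signedSum n (g + h) = signedSum n g + signedSum n h := by
  simp only [signedSum, ← Finset.sum_add_distrib]
  refine Finset.sum_congr rfl fun π _ => ?_
  split_ifs <;> simp [mul_add]

theorem signedSum_zero (g : ℕ → ℕ → ℕ → ℤ) : signedSum 0 g = g 0 0 0 := by
  have h : Avoids321 (1 : Equiv.Perm (Fin 0)) := fun ⟨i, _⟩ => i.elim0
  simp [signedSum, permStat, Subsingleton.elim (default : Equiv.Perm (Fin 0)) 1, h]

theorem signedSum_succ (n : ℕ) (g : ℕ → ℕ → ℕ → ℤ) :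
    signedSum (n + 1) g = signedSum n fun l d t =>
      ∑ v ∈ Finset.range (d + 1), (-1) ^ v *
        g (stepStat v (l, d, t)).1 (stepStat v (l, d, t)).2.1 (stepStat v (l, d, t)).2.2 := by
  rw [signedSum, ← (consEquiv n).sum_comp, Fintype.sum_prod_type_right, signedSum]
  refine Finset.sum_congr rfl fun π _ => ?_
  by_cases h : Avoids321 π
  · have ht := tracks_permStat π h
    have hav : ∀ v : Fin (n + 1),
        Avoids321 (consPerm v π) ↔ (v : ℕ) < (permStat π).2.1 + 1 := fun v => by
      rw [avoids321_consPerm, ht.tops v (by omega)]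
      simp [h]
    simp only [consEquiv_apply, hav, h, if_true, permStat_consPerm, sign_consPerm]
    rw [Fin.sum_univ_eq_sum_range (fun v => if v < (permStat π).2.1 + 1 then
      (-1) ^ v * ((Equiv.Perm.sign π : ℤˣ) : ℤ) * g (stepStat v (permStat π)).1
        (stepStat v (permStat π)).2.1 (stepStat v (permStat π)).2.2 else 0) (n + 1),
      ← Finset.sum_filter, Finset.mul_sum]
    refine Finset.sum_congr ?_ fun v _ => by ring
    ext v
    have := ht.le
    simp only [Finset.mem_filter, Finset.mem_range]
    omega
  · simp [h, consEquiv_apply, avoids321_consPerm]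

/-! ### Operators on functions of the pair `(d, t)` -/

/-- Pullback along `(d, t) ↦ (d + 1, t + 1)`. -/
def rowOp : (ℕ → ℕ → ℤ) →ₗ[ℤ] (ℕ → ℕ → ℤ) where
  toFun f d t := f (d + 1) (t + 1)
  map_add' _ _ := rfl
  map_smul' _ _ := rfl

/-- Pullback along `(d, 0) ↦ (d + 1, 0)` and `(d, t) ↦ (1, 0)` for `t ≠ 0`. -/
def colOp : (ℕ → ℕ → ℤ) →ₗ[ℤ] (ℕ → ℕ → ℤ) where
  toFun f d t := if t = 0 then f (d + 1) 0 else f 1 0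
  map_add' f g := by ext d t; simp only [Pi.add_apply]; split_ifs <;> rfl
  map_smul' r f := by ext d t; simp only [Pi.smul_apply]; split_ifs <;> rfl

/-- The contribution of the nonzero first letters which lengthen the longest increasing
subsequence. -/
def zeroOp : (ℕ → ℕ → ℤ) →ₗ[ℤ] (ℕ → ℕ → ℤ) where
  toFun f d t := if t = 0 then ∑ j ∈ Finset.range d, (-1) ^ (j + 1) * f (j + 1) 0 else 0
  map_add' f g := by
    ext d t
    simp only [Pi.add_apply]
    split_ifs <;> simp [mul_add, Finset.sum_add_distrib]
  map_smul' r f := by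
    ext d t
    simp only [Pi.smul_apply, smul_eq_mul, RingHom.id_apply]
    split_ifs <;> simp [Finset.mul_sum, mul_left_comm]

/-- The contribution of the first letters which do not lengthen the longest increasing
subsequence. -/
def keepOp : (ℕ → ℕ → ℤ) →ₗ[ℤ] (ℕ → ℕ → ℤ) where
  toFun f d t := if t = 0 then 0 else
    ∑ j ∈ Finset.range d, (-1) ^ (j + 1) * f (j + 1) (min (j + 1) t - 1)
  map_add' f g := by
    ext d t
    simp only [Pi.add_apply]
    split_ifs <;> simp [mul_add, Finset.sum_add_distrib]
  map_smul' r f := by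
    ext d t
    simp only [Pi.smul_apply, smul_eq_mul, RingHom.id_apply]
    split_ifs <;> simp [Finset.mul_sum, mul_left_comm]

theorem colOp_zeroOp (f : ℕ → ℕ → ℤ) :
    colOp (zeroOp f) = -(rowOp (colOp f) + zeroOp (colOp f)) := by
  ext d t
  by_cases ht : t = 0
  · simp only [colOp, zeroOp, rowOp, ht, LinearMap.coe_mk, AddHom.coe_mk, if_true, Pi.neg_apply,
      Pi.add_apply, Nat.add_eq_zero_iff, one_ne_zero, and_false, if_false,
      Finset.sum_range_succ' _ d, neg_add_rev, ← Finset.sum_neg_distrib]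
    congr 1
    · exact Finset.sum_congr rfl fun j _ => by ring
    · ring
  · simp [colOp, zeroOp, rowOp, ht]

theorem rowOp_zeroOp (f : ℕ → ℕ → ℤ) : rowOp (zeroOp f) = 0 := by
  ext d t
  simp [rowOp, zeroOp]

theorem colOp_keepOp (f : ℕ → ℕ → ℤ) : colOp (keepOp f) = 0 := by
  ext d t
  simp [colOp, keepOp]

theorem rowOp_keepOp (f : ℕ → ℕ → ℤ) :
    rowOp (keepOp f) = -keepOp (rowOp f) - (rowOp (colOp f) + zeroOp (colOp f)) := by
  ext d t
  by_cases ht : t = 0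
  · simp only [colOp, zeroOp, rowOp, keepOp, ht, LinearMap.coe_mk, AddHom.coe_mk, if_true,
      Pi.neg_apply, Pi.add_apply, Pi.sub_apply, Nat.add_eq_zero_iff, one_ne_zero, and_false,
      if_false, Finset.sum_range_succ' _ d, neg_zero, zero_sub, neg_add_rev,
      ← Finset.sum_neg_distrib]
    congr 1
    · refine Finset.sum_congr rfl fun j _ => ?_
      rw [show min (j + 1 + 1) (0 + 1) - 1 = 0 by omega]
      ring
    · simp
  · simp only [colOp, zeroOp, rowOp, keepOp, ht, LinearMap.coe_mk, AddHom.coe_mk, if_false,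
      Pi.neg_apply, Pi.add_apply, Pi.sub_apply, Nat.add_eq_zero_iff, one_ne_zero, and_false,
      Finset.sum_range_succ' _ d, add_zero, sub_eq_add_neg, ← Finset.sum_neg_distrib]
    congr 1
    · refine Finset.sum_congr rfl fun j _ => ?_
      rw [show min (j + 1 + 1) (t + 1) - 1 = min (j + 1) t - 1 + 1 by omega]
      ring
    · simp

/-! ### Signed sums over two-row standard tableaux -/

/-- The signed sum of `f (d, t)` over standard tableaux with rows of lengths `a ≥ b`, where `d`
is the number of entries after the last descent and `t` of these are in the first row. -/
def tableauSum : ℕ → ℕ → ((ℕ → ℕ → ℤ) →ₗ[ℤ] ℤ)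
  | 0, 0 => LinearMap.proj (φ := fun _ : ℕ => ℤ) 0 ∘ₗ LinearMap.proj (φ := fun _ : ℕ => ℕ → ℤ) 0
  | 0, _ + 1 => 0
  | a + 1, 0 => tableauSum a 0 ∘ₗ rowOp
  | a + 1, b + 1 => if b ≤ a then
      (-1 : ℤ) ^ (b + 1) • tableauSum a (b + 1) ∘ₗ rowOp + tableauSum (a + 1) b ∘ₗ colOp else 0

theorem tableauSum_eq_zero {a b : ℕ} (h : a < b) : tableauSum a b = 0 := by
  obtain ⟨b, rfl⟩ : ∃ c, b = c + 1 := ⟨b - 1, by omega⟩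
  cases a with
  | zero => simp [tableauSum]
  | succ a => rw [tableauSum, if_neg (by omega)]

theorem tableauSum_succ_zero (a : ℕ) (f : ℕ → ℕ → ℤ) :
    tableauSum (a + 1) 0 f = tableauSum a 0 (rowOp f) := by
  rw [tableauSum, LinearMap.comp_apply]

theorem tableauSum_succ_succ {a b : ℕ} (h : b ≤ a) (f : ℕ → ℕ → ℤ) :
    tableauSum (a + 1) (b + 1) f =
      (-1) ^ (b + 1) * tableauSum a (b + 1) (rowOp f) + tableauSum (a + 1) b (colOp f) := by
  rw [tableauSum, if_pos h]
  simp

theorem tableauSum_growOp (a b : ℕ) (h : b ≤ a) (f : ℕ → ℕ → ℤ) :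
    tableauSum a b (rowOp f + zeroOp f) = (-1) ^ b * tableauSum (a + 1) b f := by
  induction b generalizing f with
  | zero =>
    have hz : tableauSum a 0 (zeroOp f) = 0 := by
      cases a with
      | zero => simp [tableauSum, zeroOp]
      | succ a => rw [tableauSum_succ_zero, rowOp_zeroOp, map_zero]
    rw [map_add, hz, tableauSum_succ_zero]
    simp
  | succ b ih =>
    obtain ⟨a, rfl⟩ : ∃ c, a = c + 1 := ⟨a - 1, by omega⟩
    have hz : tableauSum (a + 1) (b + 1) (zeroOp f) =
        -((-1) ^ b * tableauSum (a + 2) b (colOp f)) := by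
      rw [tableauSum_succ_succ (by omega), rowOp_zeroOp, map_zero, colOp_zeroOp, map_neg,
        ih (by omega)]
      ring
    rw [map_add, hz, tableauSum_succ_succ (by omega) f]
    have hs : ((-1 : ℤ) ^ (b + 1)) * (-1) ^ (b + 1) = 1 := by rw [← mul_pow]; simp
    linear_combination (-tableauSum (a + 1) (b + 1) (rowOp f)) * hs

theorem tableauSum_keepOp (a b : ℕ) (h : b ≤ a) (f : ℕ → ℕ → ℤ) :
    tableauSum a b (keepOp f) = -tableauSum a (b + 1) f := by
  induction a generalizing b f with
  | zero =>
    obtain rfl : b = 0 := by omega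
    simp [tableauSum, keepOp]
  | succ a ih =>
    cases b with
    | zero =>
      rw [tableauSum_succ_zero, rowOp_keepOp, map_sub, map_neg, ih 0 (by omega),
        tableauSum_growOp a 0 (by omega), tableauSum_succ_succ (by omega)]
      ring
    | succ b =>
      rw [tableauSum_succ_succ (by omega) (keepOp f), colOp_keepOp, map_zero]
      rcases Nat.lt_or_ge a (b + 1) with hab | hab
      · simp [tableauSum_eq_zero hab, tableauSum_eq_zero (show a + 1 < b + 1 + 1 by omega)]
      · rw [rowOp_keepOp, map_sub, map_neg, ih _ hab, tableauSum_growOp a _ hab,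
          tableauSum_succ_succ hab f]
        have hs : ((-1 : ℤ) ^ (b + 1)) * (-1) ^ (b + 1) = 1 := by rw [← mul_pow]; simp
        linear_combination (-tableauSum (a + 1) (b + 1) (colOp f)) * hs

/-- The sign-imbalance, up to sign, of the two-row shape with rows of lengths `a ≥ b`. -/
def imbalance : ℕ → ℕ → ℤ
  | 0, 0 => 1
  | 0, _ + 1 => 0
  | a + 1, 0 => imbalance a 0
  | a + 1, b + 1 => if b ≤ a then
      (-1) ^ (b + 1) * imbalance a (b + 1) - imbalance (a + 1) b else 0

theorem imbalance_eq_zero {a b : ℕ} (h : a < b) : imbalance a b = 0 := by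
  obtain ⟨b, rfl⟩ : ∃ c, b = c + 1 := ⟨b - 1, by omega⟩
  cases a with
  | zero => simp [imbalance]
  | succ a => rw [imbalance, if_neg (by omega)]

theorem imbalance_succ_succ {a b : ℕ} (h : b ≤ a) : imbalance (a + 1) (b + 1) =
    (-1) ^ (b + 1) * imbalance a (b + 1) - imbalance (a + 1) b := by
  rw [imbalance, if_pos h]

theorem imbalance_even_odd (p q : ℕ) : imbalance (2 * p) (2 * q + 1) = 0 := by
  induction p generalizing q with
  | zero => simp [imbalance]
  | succ p ihp =>
    induction q with
    | zero =>
      rw [show 2 * (p + 1) = 2 * p + 1 + 1 by ring, imbalance_succ_succ (by omega),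
        imbalance_succ_succ (by omega), ihp 0, imbalance.eq_def (2 * p + 1 + 1) (2 * 0)]
      simp
    | succ q ihq =>
      rcases Nat.lt_or_ge p (q + 1) with h | h
      · exact imbalance_eq_zero (by omega)
      · have h1 := imbalance_succ_succ (a := 2 * p + 1) (b := 2 * q + 2) (by omega)
        have h2 := imbalance_succ_succ (a := 2 * p) (b := 2 * q + 2) (by omega)
        have h3 := imbalance_succ_succ (a := 2 * p + 1) (b := 2 * q + 1) (by omega)
        have h4 := ihp (q + 1)
        rw [show 2 * (q + 1) + 1 = 2 * q + 2 + 1 by ring] at h4 ⊢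
        rw [show 2 * (p + 1) = 2 * p + 1 + 1 by ring] at ihq ⊢
        rw [h4] at h2
        rw [ihq] at h3
        rw [h1, h2, h3]
        have he : (-1 : ℤ) ^ (2 * q) = 1 := by simp
        simp only [pow_succ, he]
        ring

/-! ### Factorization of the signed sum -/

theorem sum_stepStat_single_zero (f : ℕ → ℕ → ℤ) :
    (fun l d t => ∑ v ∈ Finset.range (d + 1), (-1) ^ v *
      (Pi.single 0 f : ℕ → ℕ → ℕ → ℤ) (stepStat v (l, d, t)).1 (stepStat v (l, d, t)).2.1
        (stepStat v (l, d, t)).2.2) = Pi.single 0 (keepOp f) := by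
  ext l d t
  rw [Finset.sum_range_succ']
  rcases Nat.eq_zero_or_pos l with rfl | hl
  · by_cases ht : t = 0 <;> simp [stepStat, ht, keepOp]
  · by_cases ht : t = 0 <;> simp [stepStat, ht, Pi.single_eq_of_ne hl.ne']

theorem sum_stepStat_single_succ (a : ℕ) (f : ℕ → ℕ → ℤ) :
    (fun l d t => ∑ v ∈ Finset.range (d + 1), (-1) ^ v *
      (Pi.single (a + 1) f : ℕ → ℕ → ℕ → ℤ) (stepStat v (l, d, t)).1 (stepStat v (l, d, t)).2.1
        (stepStat v (l, d, t)).2.2) =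
      Pi.single a (rowOp f + zeroOp f) + Pi.single (a + 1) (keepOp f) := by
  ext l d t
  rw [Finset.sum_range_succ']
  by_cases h1 : l = a
  · subst h1
    by_cases ht : t = 0
    · simp [stepStat, ht, rowOp, zeroOp, add_comm]
    · simp [stepStat, ht, rowOp, zeroOp]
  · have h1' : l + 1 ≠ a + 1 := by omega
    by_cases h2 : l = a + 1
    · subst h2
      by_cases ht : t = 0 <;> simp [stepStat, ht, keepOp]
    · by_cases ht : t = 0 <;>
        simp [stepStat, ht, Pi.single_eq_of_ne h1, Pi.single_eq_of_ne h2, Pi.single_eq_of_ne h1']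

theorem signedSum_single_eq_zero {n a : ℕ} (h : n < a) (f : ℕ → ℕ → ℤ) :
    signedSum n (Pi.single a f) = 0 := by
  induction n generalizing a f with
  | zero => simp [signedSum_zero, Pi.single_eq_of_ne h.ne]
  | succ n ih =>
    obtain ⟨a, rfl⟩ : ∃ c, a = c + 1 := ⟨a - 1, by omega⟩
    rw [signedSum_succ, sum_stepStat_single_succ, signedSum_add, ih (by omega), ih (by omega),
      add_zero]

theorem signedSum_single (n a b : ℕ) (h : a + b = n) (f : ℕ → ℕ → ℤ) :
    signedSum n (Pi.single a f) = imbalance a b * tableauSum a b f := by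
  induction n generalizing a b f with
  | zero =>
    obtain ⟨rfl, rfl⟩ : a = 0 ∧ b = 0 := by omega
    simp [signedSum_zero, imbalance, tableauSum]
  | succ n ih =>
    cases a with
    | zero =>
      obtain rfl : b = n + 1 := by omega
      rw [signedSum_succ, sum_stepStat_single_zero, ih 0 n (by omega)]
      cases n with
      | zero => simp [tableauSum, keepOp]
      | succ n => simp [tableauSum]
    | succ a =>
      rw [signedSum_succ, sum_stepStat_single_succ, signedSum_add, ih a b (by omega)]
      cases b with
      | zero =>
        rw [signedSum_single_eq_zero (by omega), tableauSum_growOp a 0 (by omega)]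
        simp [imbalance]
      | succ b =>
        rw [ih (a + 1) b (by omega)]
        rcases Nat.lt_or_ge a b with hab | hab
        · rw [imbalance_eq_zero (show a < b + 1 by omega),
            imbalance_eq_zero (show a + 1 < b + 1 by omega)]
          rcases Nat.lt_or_ge (a + 1) b with hab' | hab'
          · simp [imbalance_eq_zero hab']
          · rw [tableauSum_keepOp _ _ hab', tableauSum_eq_zero (show a + 1 < b + 1 by omega)]
            simp
        · rw [tableauSum_keepOp _ _ (by omega), imbalance_succ_succ hab]
          rcases Nat.lt_or_ge a (b + 1) with hab' | hab'
          · rw [imbalance_eq_zero hab']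
            ring
          · rw [tableauSum_growOp _ _ hab']
            ring

theorem eCount_sub_oCount (n l : ℕ) :
    (eCount n l : ℤ) - oCount n l = signedSum n (Pi.single l fun _ _ => 1) := by
  simp only [eCount, oCount, Nat.card_eq_fintype_card, Fintype.card_subtype, Finset.card_filter,
    Nat.cast_sum, ← Finset.sum_sub_distrib, signedSum]
  refine Finset.sum_congr rfl fun π _ => ?_
  by_cases h : Avoids321 π
  · by_cases hl : (permStat π).1 = l
    · rcases Int.units_eq_one_or (Equiv.Perm.sign π) with hs | hs <;>
        simp [h, lis_eq_permStat h, hl, hs]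
    · simp [h, lis_eq_permStat h, hl]
  · simp [h]

theorem e_eq_o_odd_even (n k : ℕ) :
    eCount (2 * n + 1) (2 * k) = oCount (2 * n + 1) (2 * k) := by
  have h := eCount_sub_oCount (2 * n + 1) (2 * k)
  rcases Nat.lt_or_ge n k with hnk | hnk
  · rw [signedSum_single_eq_zero (by omega)] at h
    omega
  · rw [signedSum_single _ (2 * k) (2 * (n - k) + 1) (by omega), imbalance_even_odd, zero_mul] at h
    omega
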